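/- Under the standing assumptions, let π̂ : X → U be a Borel-measurable policy with π̂(x) ∈ U(x) for all x, and let v, v*, v^π̂ : X → ℝ be Borel-measurable functions with finite ‖·‖_ξ-norm such that T v* = v* (pointwise), T^π̂ v^π̂ = v^π̂ (pointwise), and T^π̂ v = T v (pointwise, i.e., π̂ is greedy with respect to v). Then ‖v^π̂ − v*‖_ξ ≤ (2τ/(1−τ)) ‖v − v*‖_ξ, where τ := αβ ∈ (0,1). -/

import Mathlib

open MeasureTheory

/-- The weighted sup-norm `‖g‖_ξ := sup_x |g(x)| / ξ(x)`. -/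
noncomputable def wnorm {X : Type*} (ξ : X → ℝ) (g : X → ℝ) : ℝ :=
  ⨆ x, |g x| / ξ x

/-- The distributionally robust Bellman operator
`(T v)(x) := inf_{u ∈ U(x)} sup_{μ ∈ D} [ c(x,u) + α ∫ v(f(x,u,w)) μ(dw) ]`. -/
noncomputable def Tbell {X U W : Type*} [MeasurableSpace W]
    (f : X → U → W → X) (c : X → U → ℝ) (α : ℝ)
    (Uadm : X → Set U) (D : Set (Measure W)) (v : X → ℝ) (x : X) : ℝ :=
  ⨅ u : Uadm x, ⨆ μ : D, c x u + α * ∫ w, v (f x u w) ∂(μ : Measure W)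

/-- The policy Bellman operator
`(T^π v)(x) := sup_{μ ∈ D} [ c(x,π(x)) + α ∫ v(f(x,π(x),w)) μ(dw) ]`. -/
noncomputable def Tpol {X U W : Type*} [MeasurableSpace W]
    (f : X → U → W → X) (c : X → U → ℝ) (α : ℝ)
    (π : X → U) (D : Set (Measure W)) (v : X → ℝ) (x : X) : ℝ :=
  ⨆ μ : D, c x (π x) + α * ∫ w, v (f x (π x) w) ∂(μ : Measure W)

section WeightedSupNorm

variable {X : Type*} {ξ : X → ℝ}

lemma wnorm_nonneg (hξ : ∀ x, 0 < ξ x) (g : X → ℝ) : 0 ≤ wnorm ξ g :=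
  Real.iSup_nonneg fun x => div_nonneg (abs_nonneg _) (hξ x).le

lemma abs_le_wnorm_mul (hξ : ∀ x, 0 < ξ x) {g : X → ℝ}
    (hg : BddAbove (Set.range fun x => |g x| / ξ x)) (x : X) : |g x| ≤ wnorm ξ g * ξ x :=
  (div_le_iff₀ (hξ x)).1 (le_ciSup hg x)

lemma wnorm_le (hξ : ∀ x, 0 < ξ x) {g : X → ℝ} {k : ℝ} (hk : 0 ≤ k)
    (h : ∀ x, |g x| ≤ k * ξ x) : wnorm ξ g ≤ k :=
  Real.iSup_le (fun x => (div_le_iff₀ (hξ x)).2 (h x)) hk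

lemma bddAbove_range_abs_sub_div (hξ : ∀ x, 0 < ξ x) {g h : X → ℝ}
    (hg : BddAbove (Set.range fun x => |g x| / ξ x))
    (hh : BddAbove (Set.range fun x => |h x| / ξ x)) :
    BddAbove (Set.range fun x => |g x - h x| / ξ x) := by
  refine ⟨wnorm ξ g + wnorm ξ h, ?_⟩
  rintro _ ⟨x, rfl⟩
  rw [div_le_iff₀ (hξ x), add_mul]
  exact (abs_sub _ _).trans (add_le_add (abs_le_wnorm_mul hξ hg x) (abs_le_wnorm_mul hξ hh x))

end WeightedSupNorm

section RobustExpectation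

variable {X W : Type*} [MeasurableSpace W] {ξ : X → ℝ} {φ : W → X}
  {g h : X → ℝ} {K k : ℝ}

lemma integrable_comp_of_abs_le_mul [MeasurableSpace X] {μ : Measure W}
    (hφ : Measurable φ) (hξ : Integrable (fun w => ξ (φ w)) μ) (hg : Measurable g)
    (hgK : ∀ x, |g x| ≤ K * ξ x) :
    Integrable (fun w => g (φ w)) μ :=
  (hξ.const_mul K).mono' (hg.comp hφ).aestronglyMeasurable (ae_of_all _ fun w => hgK (φ w))

lemma abs_integral_comp_le {μ : Measure W} {B : ℝ} (hK : 0 ≤ K)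
    (hξ : Integrable (fun w => ξ (φ w)) μ) (hB : ∫ w, ξ (φ w) ∂μ ≤ B)
    (hgK : ∀ x, |g x| ≤ K * ξ x) : |∫ w, g (φ w) ∂μ| ≤ K * B := by
  refine (norm_integral_le_of_norm_le (f := fun w => g (φ w)) (hξ.const_mul K)
    (ae_of_all _ fun w => hgK (φ w))).trans ?_
  rw [integral_const_mul]
  exact mul_le_mul_of_nonneg_left hB hK

variable {D : Set (Measure W)} {c α B : ℝ}

lemma abs_cost_add_integral_le (hα : 0 ≤ α) (hK : 0 ≤ K)
    (hξ : ∀ μ ∈ D, Integrable (fun w => ξ (φ w)) μ) (hB : ∀ μ ∈ D, ∫ w, ξ (φ w) ∂μ ≤ B)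
    (hgK : ∀ x, |g x| ≤ K * ξ x) (μ : D) :
    |c + α * ∫ w, g (φ w) ∂(μ : Measure W)| ≤ |c| + α * (K * B) := by
  refine (abs_add_le _ _).trans ?_
  rw [abs_mul, abs_of_nonneg hα]
  gcongr
  exact abs_integral_comp_le hK (hξ μ μ.2) (hB μ μ.2) hgK

lemma neg_le_iSup_cost_add_integral (hD : D.Nonempty) (hα : 0 ≤ α) (hK : 0 ≤ K)
    (hξ : ∀ μ ∈ D, Integrable (fun w => ξ (φ w)) μ) (hB : ∀ μ ∈ D, ∫ w, ξ (φ w) ∂μ ≤ B)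
    (hgK : ∀ x, |g x| ≤ K * ξ x) :
    -(|c| + α * (K * B)) ≤ ⨆ μ : D, c + α * ∫ w, g (φ w) ∂(μ : Measure W) := by
  obtain ⟨μ, hμ⟩ := hD
  have key := abs_cost_add_integral_le (c := c) hα hK hξ hB hgK
  refine le_ciSup_of_le ⟨|c| + α * (K * B), ?_⟩ (⟨μ, hμ⟩ : D) (abs_le.1 (key _)).1
  rintro _ ⟨ν, rfl⟩
  exact (abs_le.1 (key ν)).2

/-- Lipschitz dependence of the robust one-stage cost on the continuation value. -/
lemma iSup_cost_add_integral_le [MeasurableSpace X] (hD : D.Nonempty) (hα : 0 ≤ α)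
    (hφ : Measurable φ)
    (hξ : ∀ μ ∈ D, Integrable (fun w => ξ (φ w)) μ) (hB : ∀ μ ∈ D, ∫ w, ξ (φ w) ∂μ ≤ B)
    (hg : Measurable g) (hh : Measurable h) (hK : 0 ≤ K) (hk : 0 ≤ k)
    (hgK : ∀ x, |g x| ≤ K * ξ x) (hhK : ∀ x, |h x| ≤ K * ξ x)
    (hgh : ∀ x, |g x - h x| ≤ k * ξ x) :
    (⨆ μ : D, c + α * ∫ w, g (φ w) ∂(μ : Measure W)) ≤
      (⨆ μ : D, c + α * ∫ w, h (φ w) ∂(μ : Measure W)) + α * (k * B) := by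
  have := hD.to_subtype
  refine ciSup_le fun μ => ?_
  have hbdd : BddAbove (Set.range fun μ : D => c + α * ∫ w, h (φ w) ∂(μ : Measure W)) := by
    refine ⟨|c| + α * (K * B), ?_⟩
    rintro _ ⟨ν, rfl⟩
    exact (abs_le.1 (abs_cost_add_integral_le hα hK hξ hB hhK ν)).2
  have hdiff := abs_integral_comp_le (g := fun x => g x - h x) hk (hξ μ μ.2) (hB μ μ.2) hgh
  rw [integral_sub (integrable_comp_of_abs_le_mul hφ (hξ μ μ.2) hg hgK)
    (integrable_comp_of_abs_le_mul hφ (hξ μ μ.2) hh hhK)] at hdiff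
  have := mul_le_mul_of_nonneg_left (abs_le.1 hdiff).2 hα
  have := le_ciSup hbdd μ
  linarith

end RobustExpectation

section BellmanContraction

variable {X U W : Type*} [MeasurableSpace X] [MeasurableSpace W] {f : X → U → W → X}
  {c : X → U → ℝ} {α b β K k : ℝ} {Uadm : X → Set U} {D : Set (Measure W)} {ξ g h : X → ℝ}

lemma abs_Tpol_sub_le (hD : D.Nonempty) (hα : 0 ≤ α) {π : X → U} {x : X}
    (hf : Measurable (f x (π x)))
    (hξ : ∀ μ ∈ D, Integrable (fun w => ξ (f x (π x) w)) μ)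
    (hβ : ∀ μ ∈ D, ∫ w, ξ (f x (π x) w) ∂μ ≤ β * ξ x)
    (hg : Measurable g) (hh : Measurable h) (hK : 0 ≤ K) (hk : 0 ≤ k)
    (hgK : ∀ x, |g x| ≤ K * ξ x) (hhK : ∀ x, |h x| ≤ K * ξ x)
    (hgh : ∀ x, |g x - h x| ≤ k * ξ x) :
    |Tpol f c α π D g x - Tpol f c α π D h x| ≤ α * (k * (β * ξ x)) := by
  have h₁ := iSup_cost_add_integral_le (c := c x (π x)) hD hα hf hξ hβ hg hh hK hk hgK hhK hgh
  have h₂ := iSup_cost_add_integral_le (c := c x (π x)) hD hα hf hξ hβ hh hg hK hk hhK hgK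
    fun x => abs_sub_comm (g x) (h x) ▸ hgh x
  unfold Tpol
  exact abs_sub_le_iff.2 ⟨by linarith, by linarith⟩

lemma Tbell_le_Tbell_add (hD : D.Nonempty) (hα : 0 ≤ α) {x : X} (hU : (Uadm x).Nonempty)
    (hf : ∀ u, Measurable (f x u))
    (hc : ∀ u ∈ Uadm x, |c x u| ≤ b * ξ x)
    (hξ : ∀ u ∈ Uadm x, ∀ μ ∈ D, Integrable (fun w => ξ (f x u w)) μ)
    (hβ : ∀ u ∈ Uadm x, ∀ μ ∈ D, ∫ w, ξ (f x u w) ∂μ ≤ β * ξ x)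
    (hg : Measurable g) (hh : Measurable h) (hK : 0 ≤ K) (hk : 0 ≤ k)
    (hgK : ∀ x, |g x| ≤ K * ξ x) (hhK : ∀ x, |h x| ≤ K * ξ x)
    (hgh : ∀ x, |g x - h x| ≤ k * ξ x) :
    Tbell f c α Uadm D g x ≤ Tbell f c α Uadm D h x + α * (k * (β * ξ x)) := by
  have := hU.to_subtype
  unfold Tbell
  rw [← sub_le_iff_le_add]
  refine le_ciInf fun u => ?_
  rw [sub_le_iff_le_add]
  refine (ciInf_le ⟨-(b * ξ x + α * (K * (β * ξ x))), ?_⟩ u).trans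
    (iSup_cost_add_integral_le hD hα (hf u) (hξ u u.2) (hβ u u.2) hg hh hK hk hgK hhK hgh)
  rintro _ ⟨u', rfl⟩
  refine le_trans ?_ (neg_le_iSup_cost_add_integral hD hα hK (hξ u' u'.2) (hβ u' u'.2) hgK)
  have := hc u' u'.2
  linarith

lemma abs_Tbell_sub_le (hD : D.Nonempty) (hα : 0 ≤ α) {x : X} (hU : (Uadm x).Nonempty)
    (hf : ∀ u, Measurable (f x u))
    (hc : ∀ u ∈ Uadm x, |c x u| ≤ b * ξ x)
    (hξ : ∀ u ∈ Uadm x, ∀ μ ∈ D, Integrable (fun w => ξ (f x u w)) μ)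
    (hβ : ∀ u ∈ Uadm x, ∀ μ ∈ D, ∫ w, ξ (f x u w) ∂μ ≤ β * ξ x)
    (hg : Measurable g) (hh : Measurable h) (hK : 0 ≤ K) (hk : 0 ≤ k)
    (hgK : ∀ x, |g x| ≤ K * ξ x) (hhK : ∀ x, |h x| ≤ K * ξ x)
    (hgh : ∀ x, |g x - h x| ≤ k * ξ x) :
    |Tbell f c α Uadm D g x - Tbell f c α Uadm D h x| ≤ α * (k * (β * ξ x)) := by
  have h₁ := Tbell_le_Tbell_add hD hα hU hf hc hξ hβ hg hh hK hk hgK hhK hgh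
  have h₂ := Tbell_le_Tbell_add hD hα hU hf hc hξ hβ hh hg hK hk hhK hgK
    fun x => abs_sub_comm (g x) (h x) ▸ hgh x
  exact abs_sub_le_iff.2 ⟨by linarith, by linarith⟩

end BellmanContraction

/-- greedy-policy suboptimality bound: if `T v* = v*`, `T^π̂ v^π̂ = v^π̂`
and `π̂` is greedy with respect to `v` (i.e. `T^π̂ v = T v` pointwise), then
`‖v^π̂ − v*‖_ξ ≤ (2τ/(1−τ)) ‖v − v*‖_ξ` with `τ := α β ∈ (0,1)`. -/
theorem greedy_policy_bound
    {n m l : ℕ} (Xs : Set (Fin n → ℝ)) (Us : Set (Fin m → ℝ)) (Ws : Set (Fin l → ℝ))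
    (hXs : MeasurableSet Xs) (hUs : MeasurableSet Us) (hWs : MeasurableSet Ws)
    (f : ↥Xs → ↥Us → ↥Ws → ↥Xs)
    (hf : Measurable fun q : (↥Xs × ↥Us) × ↥Ws => f q.1.1 q.1.2 q.2)
    (c : ↥Xs → ↥Us → ℝ) (hc : Measurable fun q : ↥Xs × ↥Us => c q.1 q.2)
    (α : ℝ) (hα0 : 0 < α) (hα1 : α < 1)
    (Uadm : ↥Xs → Set ↥Us) (hUne : ∀ x, (Uadm x).Nonempty)
    (D : Set (Measure ↥Ws)) (hDne : D.Nonempty)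
    (hDprob : ∀ μ ∈ D, IsProbabilityMeasure μ)
    (ξ : ↥Xs → ℝ) (hξm : Measurable ξ) (hξ1 : ∀ x, 1 ≤ ξ x)
    (b β : ℝ) (hb : 0 ≤ b) (hβ1 : 1 ≤ β) (hβ : β < 1 / α)
    (hcb : ∀ x, ∀ u ∈ Uadm x, |c x u| ≤ b * ξ x)
    (hξint : ∀ x, ∀ u ∈ Uadm x, ∀ μ ∈ D, Integrable (fun w => ξ (f x u w)) μ)
    (hξbound : ∀ x, ∀ u ∈ Uadm x, ∀ μ ∈ D, ∫ w, ξ (f x u w) ∂μ ≤ β * ξ x)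
    (πhat : ↥Xs → ↥Us) (hπm : Measurable πhat) (hπadm : ∀ x, πhat x ∈ Uadm x)
    (v vstar vπ : ↥Xs → ℝ)
    (hvm : Measurable v) (hvstarm : Measurable vstar) (hvπm : Measurable vπ)
    (hvb : BddAbove (Set.range fun x => |v x| / ξ x))
    (hvstarb : BddAbove (Set.range fun x => |vstar x| / ξ x))
    (hvπb : BddAbove (Set.range fun x => |vπ x| / ξ x))
    (hfix : ∀ x, Tbell f c α Uadm D vstar x = vstar x)
    (hfixπ : ∀ x, Tpol f c α πhat D vπ x = vπ x)
    (hgreedy : ∀ x, Tpol f c α πhat D v x = Tbell f c α Uadm D v x) :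
    wnorm ξ (fun x => vπ x - vstar x)
      ≤ (2 * (α * β) / (1 - α * β)) * wnorm ξ (fun x => v x - vstar x) := by
  have hξ0 : ∀ x, 0 < ξ x := fun x => zero_lt_one.trans_le (hξ1 x)
  have hτ : α * β < 1 := by rwa [lt_div_iff₀ hα0, mul_comm] at hβ
  have hfm : ∀ x u, Measurable (f x u) := fun x u =>
    hf.comp (measurable_prodMk_left (x := (x, u)))
  set a := wnorm ξ fun x => vπ x - vstar x
  set d := wnorm ξ fun x => v x - vstar x
  have ha0 : 0 ≤ a := wnorm_nonneg hξ0 _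
  have hd0 : 0 ≤ d := wnorm_nonneg hξ0 _
  have ha := abs_le_wnorm_mul hξ0 (bddAbove_range_abs_sub_div hξ0 hvπb hvstarb)
  have hd := abs_le_wnorm_mul hξ0 (bddAbove_range_abs_sub_div hξ0 hvb hvstarb)
  have hvπv : ∀ x, |vπ x - v x| ≤ (a + d) * ξ x := fun x => by
    have := abs_sub_le (vπ x) (vstar x) (v x)
    rw [abs_sub_comm (vstar x)] at this
    linarith [ha x, hd x]
  set K := wnorm ξ v + wnorm ξ vstar + wnorm ξ vπ
  have hv0 := wnorm_nonneg hξ0 v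
  have hvstar0 := wnorm_nonneg hξ0 vstar
  have hvπ0 := wnorm_nonneg hξ0 vπ
  have hK : 0 ≤ K := by positivity
  have hvK : ∀ x, |v x| ≤ K * ξ x := fun x => (abs_le_wnorm_mul hξ0 hvb x).trans
    (mul_le_mul_of_nonneg_right (by linarith) (hξ0 x).le)
  have hvstarK : ∀ x, |vstar x| ≤ K * ξ x := fun x => (abs_le_wnorm_mul hξ0 hvstarb x).trans
    (mul_le_mul_of_nonneg_right (by linarith) (hξ0 x).le)
  have hvπK : ∀ x, |vπ x| ≤ K * ξ x := fun x => (abs_le_wnorm_mul hξ0 hvπb x).trans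
    (mul_le_mul_of_nonneg_right (by linarith) (hξ0 x).le)
  have hle : a ≤ α * β * (a + 2 * d) := by
    refine wnorm_le hξ0 (by positivity) fun x => ?_
    have h₁ := abs_Tpol_sub_le (c := c) hDne hα0.le (hfm x (πhat x)) (hξint x _ (hπadm x))
      (hξbound x _ (hπadm x)) hvπm hvm hK (add_nonneg ha0 hd0) hvπK hvK hvπv
    have h₂ := abs_Tbell_sub_le hDne hα0.le (hUne x) (hfm x) (hcb x) (hξint x) (hξbound x)
      hvm hvstarm hK hd0 hvK hvstarK hd
    rw [hfixπ, hgreedy] at h₁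
    rw [hfix] at h₂
    have := abs_sub_le (vπ x) (Tbell f c α Uadm D v x) (vstar x)
    linarith
  rw [div_mul_eq_mul_div, le_div_iff₀ (by linarith)]
  linarith
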